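/- arXiv:2312.16666 — 2 statements merged into one kernel-verified Lean document; each statement's English description precedes it below -/
import Mathlib

section
/- Suppose W is finite with longest element w_S, and let I, J ⊆ S. Then the (I,J)-coset W_I·w_S·W_J is core if and only if I = w_S·J·w_S (that is, I equals the set {w_S·u·w_S : u ∈ J}). -/
namespace CoxeterAtoms

variable {B : Type*} {W : Type*} [Group W] {M : CoxeterMatrix B}

/-- The standard parabolic subgroup `W_K` generated by the simple reflections indexed by `K`. -/
def par (cs : CoxeterSystem M W) (K : Set B) : Subgroup W :=
  Subgroup.closure (cs.simple '' K)

/-- `K` is finitary if `W_K` is finite. -/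
def Finitary (cs : CoxeterSystem M W) (K : Set B) : Prop :=
  ((par cs K : Set W)).Finite

/-- The left coset `W_I · x`. -/
def lcos (cs : CoxeterSystem M W) (I : Set B) (x : W) : Set W :=
  {w | ∃ a ∈ par cs I, w = a * x}

/-- The right coset `x · W_J`. -/
def rcos (cs : CoxeterSystem M W) (x : W) (J : Set B) : Set W :=
  {w | ∃ b ∈ par cs J, w = x * b}

/-- The double coset `W_I · x · W_J`. -/
def dcos (cs : CoxeterSystem M W) (I : Set B) (x : W) (J : Set B) : Set W :=
  {w | ∃ a ∈ par cs I, ∃ b ∈ par cs J, w = a * x * b}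

/-- `x` is a minimal length element of its double coset `W_I · x · W_J`. -/
def IsMinRep (cs : CoxeterSystem M W) (I : Set B) (x : W) (J : Set B) : Prop :=
  ∀ w ∈ dcos cs I x J, cs.length x ≤ cs.length w

/-- `y` is a maximal length element of the set `p`. -/
def IsMaxOf (cs : CoxeterSystem M W) (p : Set W) (y : W) : Prop :=
  y ∈ p ∧ ∀ w ∈ p, cs.length w ≤ cs.length y

/-- `y` is the longest element of the standard parabolic subgroup `W_K`. -/
def IsLongest (cs : CoxeterSystem M W) (K : Set B) (y : W) : Prop :=
  y ∈ par cs K ∧ ∀ w ∈ par cs K, cs.length w ≤ cs.length y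

/-- The double coset `W_I · x · W_J` is core: `W_I·x = W_I·x·W_J = x·W_J`. -/
def IsCore (cs : CoxeterSystem M W) (I : Set B) (x : W) (J : Set B) : Prop :=
  lcos cs I x = dcos cs I x J ∧ dcos cs I x J = rcos cs x J

open Classical in
/-- The involution of `W × ℤ/2` attached to a simple reflection. -/
noncomputable def fl (cs : CoxeterSystem M W) (i : B) : Equiv.Perm (W × ZMod 2) where
  toFun p := (cs.simple i * p.1 * cs.simple i, p.2 + if p.1 = cs.simple i then 1 else 0)
  invFun p := (cs.simple i * p.1 * cs.simple i, p.2 + if p.1 = cs.simple i then 1 else 0)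
  left_inv := by
    rintro ⟨t, e⟩
    have h : cs.simple i * t * cs.simple i = cs.simple i ↔ t = cs.simple i := by
      constructor
      · intro h
        have := congrArg (fun x => cs.simple i * x * cs.simple i) h
        simpa [mul_assoc] using this
      · rintro rfl; simp
    ext
    · simp [mul_assoc]
    · simp only [h, add_assoc]
      split_ifs <;> simp [CharTwo.add_self_eq_zero]
  right_inv := by
    rintro ⟨t, e⟩
    have h : cs.simple i * t * cs.simple i = cs.simple i ↔ t = cs.simple i := by
      constructor
      · intro h
        have := congrArg (fun x => cs.simple i * x * cs.simple i) h
        simpa [mul_assoc] using this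
      · rintro rfl; simp
    ext
    · simp [mul_assoc]
    · simp only [h, add_assoc]
      split_ifs <;> simp [CharTwo.add_self_eq_zero]

open Classical in
theorem fl_apply (cs : CoxeterSystem M W) (i : B) (t : W) (e : ZMod 2) :
    fl cs i (t, e) =
      (cs.simple i * t * cs.simple i, e + if t = cs.simple i then 1 else 0) := rfl

theorem conj_pow_aux (cs : CoxeterSystem M W) (i j : B) (n : ℕ) :
    (cs.simple i * cs.simple j) ^ n * cs.simple j * (cs.simple i * cs.simple j) ^ n
      = cs.simple j := by
  induction n with
  | zero => simp
  | succ n ih =>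
    calc _ = (cs.simple i * cs.simple j) ^ n * (cs.simple i * cs.simple j) * cs.simple j *
          ((cs.simple i * cs.simple j) * (cs.simple i * cs.simple j) ^ n) := by
            rw [← pow_succ, ← pow_succ']
      _ = (cs.simple i * cs.simple j) ^ n *
        ((cs.simple i * cs.simple j) * cs.simple j * (cs.simple i * cs.simple j)) *
          (cs.simple i * cs.simple j) ^ n := by simp only [mul_assoc]
      _ = (cs.simple i * cs.simple j) ^ n * cs.simple j * (cs.simple i * cs.simple j) ^ n := by
        simp [mul_assoc]
      _ = _ := ih

open Classical in
theorem fl_pow (cs : CoxeterSystem M W) (i j : B) (n : ℕ) (t : W) (e : ZMod 2) :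
    ((fl cs i * fl cs j) ^ n) (t, e) =
      ((cs.simple i * cs.simple j) ^ n * t * ((cs.simple i * cs.simple j) ^ n)⁻¹,
        e + ∑ k ∈ Finset.range (2 * n),
          if t = cs.simple j * (cs.simple i * cs.simple j) ^ k then 1 else 0) := by
  induction n with
  | zero => simp
  | succ n ih =>
    rw [pow_succ', Equiv.Perm.mul_apply, ih, Equiv.Perm.mul_apply, fl_apply, fl_apply]
    have key := conj_pow_aux cs i j n
    have hj : cs.simple j * cs.simple j = 1 := by simp
    have hi : cs.simple i * cs.simple i = 1 := by simp
    generalize ha : cs.simple i * cs.simple j = a at *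
    have e1 : (a ^ n * t * (a ^ n)⁻¹ = cs.simple j) ↔ t = cs.simple j * a ^ (2 * n) := by
      rw [mul_inv_eq_iff_eq_mul, two_mul, pow_add, ← mul_right_inj (a ^ n) (b := t),
        ← mul_assoc, ← mul_assoc, key]
    have e2 : (cs.simple j * (a ^ n * t * (a ^ n)⁻¹) * cs.simple j = cs.simple i) ↔
        t = cs.simple j * a ^ (2 * n + 1) := by
      have h1 : a ^ n * (cs.simple j * a ^ (2 * n + 1)) = cs.simple j * a * a ^ n := by
        rw [show 2 * n + 1 = n + (1 + n) by ring, pow_add, pow_add, pow_one, ← mul_assoc,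
          ← mul_assoc, key, ← mul_assoc]
      rw [← mul_right_inj (a ^ n) (b := t), h1, ← mul_inv_eq_iff_eq_mul]
      generalize a ^ n * t * (a ^ n)⁻¹ = u
      rw [← ha]
      constructor
      · intro h; rw [← h]; simp [mul_assoc]
      · intro h; rw [h]; simp [mul_assoc]
    ext
    · simp only [pow_succ', ← ha, mul_inv_rev, mul_assoc, cs.inv_simple]
    · simp only [e1, e2]
      rw [show 2 * (n + 1) = 2 * n + 1 + 1 by ring, Finset.sum_range_succ,
        Finset.sum_range_succ]
      simp only [add_assoc]

theorem fl_liftable (cs : CoxeterSystem M W) : M.IsLiftable (fl cs) := by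
  classical
  intro i j
  ext1 ⟨t, e⟩
  rw [fl_pow, cs.simple_mul_simple_pow, two_mul, Finset.sum_range_add]
  simp only [pow_add, cs.simple_mul_simple_pow, one_mul, CharTwo.add_self_eq_zero]
  simp

/-- The reflection representation on `W × ℤ/2`. -/
noncomputable def Phi (cs : CoxeterSystem M W) : W →* Equiv.Perm (W × ZMod 2) :=
  cs.lift ⟨fl cs, fl_liftable cs⟩

theorem Phi_simple (cs : CoxeterSystem M W) (i : B) : Phi cs (cs.simple i) = fl cs i :=
  cs.lift_apply_simple (fl_liftable cs) i

open Classical in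
theorem Phi_word (cs : CoxeterSystem M W) (ω : List B) (t : W) (e : ZMod 2) :
    Phi cs (cs.wordProd ω) (t, e) =
      (cs.wordProd ω * t * (cs.wordProd ω)⁻¹, e + ((cs.rightInvSeq ω).count t : ℕ)) := by
  induction ω with
  | nil => simp
  | cons i ω ih =>
    rw [cs.wordProd_cons, map_mul, Equiv.Perm.mul_apply, ih, Phi_simple, fl_apply]
    have h : (cs.wordProd ω * t * (cs.wordProd ω)⁻¹ = cs.simple i) ↔
        (cs.wordProd ω)⁻¹ * cs.simple i * cs.wordProd ω = t := by
      constructor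
      · intro h; rw [← h]; group
      · intro h; rw [← h]; group
    ext
    · simp [mul_assoc]
    · simp only [h, CoxeterSystem.rightInvSeq, List.count_cons, beq_iff_eq]
      push_cast
      simp only [add_assoc]

theorem Phi_fst (cs : CoxeterSystem M W) (w t : W) (e : ZMod 2) :
    Phi cs w (t, e) = (w * t * w⁻¹, e + (Phi cs w (t, 0)).2) := by
  obtain ⟨ω, rfl⟩ := cs.wordProd_surjective w
  simp [Phi_word]

theorem Phi_refl (cs : CoxeterSystem M W) (t : W) (ht : cs.IsReflection t) (e : ZMod 2) :
    Phi cs t (t, e) = (t, e + 1) := by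
  obtain ⟨w, i, rfl⟩ := ht
  have h1 : Phi cs w (Phi cs w⁻¹ (w * cs.simple i * w⁻¹, e)) = (w * cs.simple i * w⁻¹, e) := by
    rw [← Equiv.Perm.mul_apply, ← map_mul]; simp
  rw [map_mul, map_mul, Equiv.Perm.mul_apply, Equiv.Perm.mul_apply]
  rw [Phi_fst cs w⁻¹] at h1 ⊢
  have h2 : w⁻¹ * (w * cs.simple i * w⁻¹) * w⁻¹⁻¹ = cs.simple i := by group
  rw [h2] at h1 ⊢
  rw [Phi_simple, fl_apply, Phi_fst] at *
  have h3 := congrArg Prod.snd h1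
  simp only at h3
  ext
  · simp
  · simp only [if_true]
    rw [cs.simple_mul_simple_self, one_mul]
    linear_combination h3

theorem strong_exchange (cs : CoxeterSystem M W) (ω : List B) (t : W) (ht : cs.IsReflection t)
    (hl : cs.length (cs.wordProd ω * t) < cs.length (cs.wordProd ω)) :
    ∃ j < ω.length, cs.wordProd ω * t = cs.wordProd (ω.eraseIdx j) := by
  classical
  have hmem : t ∈ cs.rightInvSeq ω := by
    by_contra hn
    obtain ⟨α, hα, hαw⟩ := cs.exists_isReduced (cs.wordProd ω * t)
    have h1 : Phi cs (cs.wordProd ω * t) (t, 0) = (cs.wordProd ω * t * (cs.wordProd ω)⁻¹, 1) := by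
      rw [map_mul, Equiv.Perm.mul_apply, Phi_refl cs t ht, Phi_word,
        List.count_eq_zero_of_not_mem hn]
      simp
    rw [hαw, Phi_word] at h1
    have h2 := congrArg Prod.snd h1
    have h3 : t ∈ cs.rightInvSeq α := by
      by_contra hn
      rw [List.count_eq_zero_of_not_mem hn] at h2
      simp at h2
    have h4 := (cs.isRightInversion_of_mem_rightInvSeq hα h3).2
    rw [← hαw, mul_assoc, ht.mul_self, mul_one] at h4
    omega
  obtain ⟨j, hj, hjt⟩ := List.mem_iff_getElem.mp hmem
  refine ⟨j, by simpa using hj, ?_⟩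
  rw [← cs.wordProd_mul_getD_rightInvSeq, List.getD_eq_getElem _ 1 hj, hjt]

theorem length_longest (cs : CoxeterSystem M W) (wS : W)
    (hwS : ∀ w : W, cs.length w ≤ cs.length wS) (ω : List B) (hω : cs.IsReduced ω) :
    cs.length (wS * (cs.wordProd ω)⁻¹) + cs.length (cs.wordProd ω) = cs.length wS := by
  induction ω with
  | nil => simp
  | cons i ω ih =>
    have hω' : cs.IsReduced ω := by simpa using hω.drop 1
    have ih := ih hω'
    have hlen : cs.length (cs.wordProd (i :: ω)) = ω.length + 1 := hω
    have hlen' : cs.length (cs.wordProd ω) = ω.length := hω'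
    obtain ⟨α, hα, hαw⟩ := cs.exists_isReduced (wS * (cs.wordProd ω)⁻¹)
    have hαl : cs.length (cs.wordProd α) = α.length := hα
    have hw : wS = cs.wordProd (α ++ ω) := by
      rw [cs.wordProd_append, ← hαw]; group
    have ht : cs.IsReflection ((cs.wordProd ω)⁻¹ * cs.simple i * cs.wordProd ω) :=
      ⟨(cs.wordProd ω)⁻¹, i, by group⟩
    have hlt := lt_of_le_of_ne
      (hwS (wS * ((cs.wordProd ω)⁻¹ * cs.simple i * cs.wordProd ω))) (ht.length_mul_left_ne wS)
    rw [hw] at hlt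
    obtain ⟨j, hj, hjw⟩ := strong_exchange cs _ _ ht hlt
    rw [List.length_append] at hj
    have htri := cs.length_mul_le (wS * (cs.wordProd (i :: ω))⁻¹) (cs.wordProd (i :: ω))
    rw [inv_mul_cancel_right] at htri
    by_cases hjα : j < α.length
    · rw [List.eraseIdx_append_of_lt_length hjα, cs.wordProd_append, cs.wordProd_append] at hjw
      have h1 : wS * (cs.wordProd (i :: ω))⁻¹ = cs.wordProd (α.eraseIdx j) := by
        rw [cs.wordProd_cons, mul_inv_rev, cs.inv_simple, ← mul_assoc, hαw]
        apply mul_right_cancel (b := cs.wordProd ω)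
        rw [← hjw]; group
      have h2 := cs.length_wordProd_le (α.eraseIdx j)
      have h3 := List.length_eraseIdx_add_one hjα
      rw [← h1] at h2
      rw [hαw] at ih
      omega
    · exfalso
      push Not at hjα
      rw [List.eraseIdx_append_of_length_le hjα, cs.wordProd_append, cs.wordProd_append] at hjw
      have h1 : cs.wordProd (i :: ω) = cs.wordProd (ω.eraseIdx (j - α.length)) := by
        rw [cs.wordProd_cons]
        apply mul_left_cancel (a := cs.wordProd α)
        rw [← hjw]; group
      have h2 := cs.length_wordProd_le (ω.eraseIdx (j - α.length))
      have h3 := List.length_eraseIdx_add_one (l := ω) (i := j - α.length) (by omega)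
      rw [← h1] at h2
      omega

theorem length_longest' (cs : CoxeterSystem M W) (wS : W)
    (hwS : ∀ w : W, cs.length w ≤ cs.length wS) (w : W) :
    cs.length (wS * w) + cs.length w = cs.length wS := by
  obtain ⟨α, hα, hαw⟩ := cs.exists_isReduced w⁻¹
  have := length_longest cs wS hwS α hα
  rwa [← hαw, inv_inv, cs.length_inv] at this

theorem longest_sq (cs : CoxeterSystem M W) (wS : W)
    (hwS : ∀ w : W, cs.length w ≤ cs.length wS) : wS * wS = 1 := by
  have := length_longest' cs wS hwS wS
  rw [← cs.length_eq_zero_iff]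
  omega

theorem length_conj (cs : CoxeterSystem M W) (wS : W)
    (hwS : ∀ w : W, cs.length w ≤ cs.length wS) (w : W) :
    cs.length (wS * w * wS) = cs.length w := by
  have h1 := length_longest' cs wS hwS (w * wS)
  have h2 := length_longest' cs wS hwS w⁻¹
  have h3 : wS⁻¹ = wS := inv_eq_of_mul_eq_one_left (longest_sq cs wS hwS)
  have h4 : cs.length (w * wS) = cs.length (wS * w⁻¹) := by
    rw [← cs.length_inv, mul_inv_rev, h3]
  rw [cs.length_inv] at h2
  rw [← mul_assoc] at h1
  omega

theorem par_reduced (cs : CoxeterSystem M W) (K : Set B) (w : W) (hw : w ∈ par cs K) :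
    ∃ ω : List B, cs.IsReduced ω ∧ (∀ k ∈ ω, k ∈ K) ∧ w = cs.wordProd ω := by
  have step : ∀ (x : W) (i : B), i ∈ K →
      (∃ ω : List B, cs.IsReduced ω ∧ (∀ k ∈ ω, k ∈ K) ∧ x = cs.wordProd ω) →
      ∃ ω : List B, cs.IsReduced ω ∧ (∀ k ∈ ω, k ∈ K) ∧ x * cs.simple i = cs.wordProd ω := by
    rintro _ i hi ⟨ω, hω, hK, rfl⟩
    have hl : cs.length (cs.wordProd ω) = ω.length := hω
    rcases cs.length_mul_simple (cs.wordProd ω) i with h | h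
    · refine ⟨ω ++ [i], ?_, ?_, by simp [cs.wordProd_append]⟩
      · simp only [CoxeterSystem.IsReduced, cs.wordProd_append, cs.wordProd_singleton,
          List.length_append, List.length_singleton]
        omega
      · intro k hk
        rcases List.mem_append.mp hk with hk | hk
        · exact hK k hk
        · rw [List.mem_singleton.mp hk]; exact hi
    · obtain ⟨j, hj, hjw⟩ := strong_exchange cs ω _ (cs.isReflection_simple i) (by omega)
      refine ⟨ω.eraseIdx j, ?_, fun k hk => hK k (List.mem_of_mem_eraseIdx hk), hjw⟩
      have := List.length_eraseIdx_add_one hj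
      simp only [CoxeterSystem.IsReduced, ← hjw]
      omega
  induction hw using Subgroup.closure_induction_right with
  | one => exact ⟨[], by simp [CoxeterSystem.IsReduced], by simp, by simp⟩
  | mul_right x hx y hy ih =>
    obtain ⟨i, hi, rfl⟩ := hy
    exact step x i hi ih
  | mul_inv_cancel x hx y hy ih =>
    obtain ⟨i, hi, rfl⟩ := hy
    rw [cs.inv_simple]
    exact step x i hi ih

theorem simple_mem_par (cs : CoxeterSystem M W) (K : Set B) (w : W) (hw : w ∈ par cs K)
    (hl : cs.length w = 1) : w ∈ cs.simple '' K := by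
  obtain ⟨ω, hω, hK, rfl⟩ := par_reduced cs K w hw
  have : ω.length = 1 := by rw [← hl]; exact hω.symm
  obtain ⟨i, rfl⟩ := List.length_eq_one_iff.mp this
  exact ⟨i, hK i (by simp), by simp⟩

theorem par_conj (cs : CoxeterSystem M W) (wS : W) (hsq : wS * wS = 1) (I J : Set B)
    (h : ∀ j ∈ J, wS * cs.simple j * wS ∈ par cs I) (b : W) (hb : b ∈ par cs J) :
    wS * b * wS ∈ par cs I := by
  have hinv : wS⁻¹ = wS := inv_eq_of_mul_eq_one_left hsq
  have hle : par cs J ≤ (par cs I).comap (MulAut.conj wS).toMonoidHom := by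
    rw [par, Subgroup.closure_le]
    rintro _ ⟨j, hj, rfl⟩
    simpa [hinv] using h j hj
  simpa [hinv] using hle hb

theorem statement_0 (cs : CoxeterSystem M W) [Finite W] (wS : W)
    (hwS : ∀ w : W, cs.length w ≤ cs.length wS)
    (I J : Set B) :
    IsCore cs I wS J ↔
      cs.simple '' I = (fun v => wS * v * wS) '' (cs.simple '' J) := by
  have hsq := longest_sq cs wS hwS
  have hcc : ∀ x : W, wS * (wS * x * wS) * wS = x := by
    intro x
    calc _ = (wS * wS) * x * (wS * wS) := by simp only [mul_assoc]
      _ = x := by simp [hsq]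
  have hc1 : ∀ x : W, (wS * x * wS) * wS = wS * x := by
    intro x; rw [mul_assoc, hsq, mul_one]
  have hc2 : ∀ x : W, wS * (wS * x * wS) = x * wS := by
    intro x; rw [mul_assoc wS x, ← mul_assoc, hsq, one_mul]
  have hs : ∀ (K : Set B) (k : B), k ∈ K → cs.simple k ∈ par cs K := fun K k hk =>
    Subgroup.subset_closure ⟨k, hk, rfl⟩
  constructor
  · rintro ⟨h1, h2⟩
    have h := h1.trans h2
    ext v
    constructor
    · rintro ⟨i, hi, rfl⟩
      have : cs.simple i * wS ∈ rcos cs wS J := h ▸ ⟨_, hs I i hi, rfl⟩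
      obtain ⟨b, hb, hbe⟩ := this
      have hb' : wS * cs.simple i * wS = b := by
        rw [mul_assoc, hbe, ← mul_assoc, hsq, one_mul]
      refine ⟨b, simple_mem_par cs J b hb ?_, ?_⟩
      · rw [← hb', length_conj cs wS hwS, cs.length_simple]
      · simp only [← hb', hcc]
    · rintro ⟨_, ⟨j, hj, rfl⟩, rfl⟩
      have : wS * cs.simple j ∈ lcos cs I wS := h ▸ ⟨_, hs J j hj, rfl⟩
      obtain ⟨a, ha, hae⟩ := this
      have ha' : wS * cs.simple j * wS = a := by
        rw [hae, mul_assoc, hsq, mul_one]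
      refine simple_mem_par cs I _ (by simp only [ha']; exact ha) ?_
      rw [length_conj cs wS hwS, cs.length_simple]
  · intro h
    have hJI : ∀ b ∈ par cs J, wS * b * wS ∈ par cs I := by
      apply par_conj cs wS hsq
      intro j hj
      apply Subgroup.subset_closure
      rw [h]
      exact ⟨_, ⟨j, hj, rfl⟩, rfl⟩
    have hIJ : ∀ a ∈ par cs I, wS * a * wS ∈ par cs J := by
      apply par_conj cs wS hsq
      intro i hi
      have : cs.simple i ∈ cs.simple '' I := ⟨i, hi, rfl⟩
      rw [h] at this
      obtain ⟨v, hv, hve⟩ := this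
      simp only at hve
      rw [← hve, hcc]
      exact Subgroup.subset_closure hv
    constructor
    · ext w
      constructor
      · rintro ⟨a, ha, rfl⟩
        exact ⟨a, ha, 1, one_mem _, by simp⟩
      · rintro ⟨a, ha, b, hb, rfl⟩
        exact ⟨a * (wS * b * wS), mul_mem ha (hJI b hb), by rw [mul_assoc, mul_assoc, hc1]⟩
    · ext w
      constructor
      · rintro ⟨a, ha, b, hb, rfl⟩
        exact ⟨(wS * a * wS) * b, mul_mem (hIJ a ha) hb, by rw [← mul_assoc, hc2]⟩
      · rintro ⟨b, hb, rfl⟩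
        exact ⟨1, one_mem _, b, hb, by simp⟩

end CoxeterAtoms
end

section
/- Let K ⊆ S be finitary and s, t ∈ K. The (K∖{s}, K∖{t})-coset W_{K∖{s}}·w_K·W_{K∖{t}} is core if and only if t = w_K·s·w_K. -/
namespace CoxeterAtoms

variable {B : Type*} {W : Type*} [Group W] {M : CoxeterMatrix B}

/-! ### The geometric representation and injectivity of `simple` -/

/-- Entries of the Cartan-type matrix of `M`. -/
noncomputable def car (M : CoxeterMatrix B) (i j : B) : ℝ :=
  -2 * Real.cos (Real.pi / (M i j : ℝ))

/-- Linear form attached to `i`. -/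
noncomputable def gform (M : CoxeterMatrix B) (i : B) : Module.Dual ℝ (B →₀ ℝ) :=
  Finsupp.linearCombination ℝ (car M i)

theorem gform_single (i j : B) : gform M i (Finsupp.single j 1) = car M i j := by
  simp [gform]

theorem gform_self (i : B) : gform M i (Finsupp.single i 1) = 2 := by
  rw [gform_single, car]; simp

/-- The reflection attached to `i`. -/
noncomputable def grefl (M : CoxeterMatrix B) (i : B) : (B →₀ ℝ) ≃ₗ[ℝ] (B →₀ ℝ) :=
  Module.reflection (gform_self (M := M) i)

theorem grefl_apply (i : B) (z : B →₀ ℝ) :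
    grefl M i z = z - gform M i z • Finsupp.single i 1 := by
  simp [grefl, Module.reflection_apply]

theorem S_zero_aux (m : ℕ) (hm : 3 ≤ m) (t : ℝ) (ht : t = 2 * Real.cos (2 * Real.pi / m)) :
    ((Polynomial.Chebyshev.S ℝ (((m : ℤ) - 2) / 2)).eval t *
      ((Polynomial.Chebyshev.S ℝ (((m : ℤ) - 1) / 2)).eval t +
        (Polynomial.Chebyshev.S ℝ (((m : ℤ) - 3) / 2)).eval t)) = 0 ∧
    ((Polynomial.Chebyshev.S ℝ (((m : ℤ) - 1) / 2)).eval t *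
      ((Polynomial.Chebyshev.S ℝ ((m : ℤ) / 2)).eval t +
        (Polynomial.Chebyshev.S ℝ (((m : ℤ) - 2) / 2)).eval t)) = 0 := by
  have hm0 : (0 : ℝ) < m := by positivity
  have hm3 : (3 : ℝ) ≤ m := by exact_mod_cast hm
  have hsin : Real.sin (2 * Real.pi / m) ≠ 0 := by
    apply ne_of_gt
    apply Real.sin_pos_of_pos_of_lt_pi
    · positivity
    · rw [div_lt_iff₀ hm0]; nlinarith [Real.pi_pos]
  have key := fun n : ℤ => Polynomial.Chebyshev.S_two_mul_real_cos (2 * Real.pi / m) n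
  rw [← ht] at key
  rcases Nat.even_or_odd' m with ⟨k, rfl | rfl⟩
  · have e1 : (((2 * k : ℕ) : ℤ) - 2) / 2 = k - 1 := by omega
    have e2 : (((2 * k : ℕ) : ℤ) - 1) / 2 = k - 1 := by omega
    have h0 : (Polynomial.Chebyshev.S ℝ ((k : ℤ) - 1)).eval t = 0 := by
      have := key ((k : ℤ) - 1)
      have hk : (k : ℝ) ≠ 0 := by
        have : k ≠ 0 := by omega
        exact_mod_cast this
      have e : ((((k : ℤ) - 1 : ℤ) : ℝ) + 1) * (2 * Real.pi / ((2 * k : ℕ) : ℝ)) = Real.pi := by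
        push_cast; field_simp; ring
      rw [e, Real.sin_pi] at this
      exact (mul_eq_zero.mp this).resolve_right hsin
    rw [e1, e2, h0]; simp
  · have e1 : (((2 * k + 1 : ℕ) : ℤ) - 2) / 2 = k - 1 := by omega
    have e2 : (((2 * k + 1 : ℕ) : ℤ) - 1) / 2 = k := by omega
    have e3 : (((2 * k + 1 : ℕ) : ℤ) - 3) / 2 = k - 1 := by omega
    have e4 : (((2 * k + 1 : ℕ) : ℤ)) / 2 = k := by omega
    have h0 : (Polynomial.Chebyshev.S ℝ (k : ℤ)).eval t
        + (Polynomial.Chebyshev.S ℝ ((k : ℤ) - 1)).eval t = 0 := by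
      have h1 := key ((k : ℤ) - 1)
      have h2 := key (k : ℤ)
      have e : (((k : ℤ) : ℝ) + 1) * (2 * Real.pi / ((2 * k + 1 : ℕ) : ℝ))
          = 2 * Real.pi - ((((k : ℤ) - 1 : ℤ) : ℝ) + 1) * (2 * Real.pi / ((2 * k + 1 : ℕ) : ℝ)) := by
        push_cast; field_simp; ring
      rw [e, Real.sin_two_pi_sub, ← h1] at h2
      apply (mul_eq_zero.mp (?_ : _ * Real.sin (2 * Real.pi / ((2 * k + 1 : ℕ) : ℝ)) = 0)).resolve_right hsin
      rw [add_mul, h2]; ring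
    rw [e1, e2, e3, e4, h0]; simp

theorem grefl_liftable (M : CoxeterMatrix B) : M.IsLiftable (grefl M) := by
  intro i j
  have hsym : M j i = M i j := M.symmetric j i
  by_cases hij : i = j
  · subst hij
    rw [M.diagonal, pow_one]
    ext1 z
    exact Module.involutive_reflection (gform_self (M := M) i) z
  have h1 : M i j ≠ 1 := M.off_diagonal i j hij
  by_cases h0 : M i j = 0
  · rw [h0, pow_zero]
  by_cases h2 : M i j = 2
  · have c1 : car M i j = 0 := by simp [car, h2]
    have c2 : car M j i = 0 := by simp [car, hsym, h2]
    rw [h2, pow_two]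
    apply LinearEquiv.ext
    intro z
    simp only [LinearEquiv.mul_apply, grefl_apply, map_sub, map_smul, gform_single, c1, c2,
      LinearEquiv.coe_one, id_eq]
    have d1 : car M i i = 2 := by simp [car]
    have d2 : car M j j = 2 := by simp [car]
    rw [d1, d2]
    module
  · have h3 : 3 ≤ M i j := by omega
    apply LinearEquiv.ext
    intro z
    have ht : 2 * Real.cos (2 * Real.pi / (M i j : ℝ)) =
        gform M i (Finsupp.single j 1) * gform M j (Finsupp.single i 1) - 2 := by
      rw [gform_single, gform_single, car, car, hsym,
        show 2 * Real.pi / (M i j : ℝ) = 2 * (Real.pi / (M i j : ℝ)) by ring, Real.cos_two_mul]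
      ring
    have := Module.reflection_mul_reflection_pow_apply (gform_self (M := M) i)
      (gform_self (M := M) j) (M i j) z (2 * Real.cos (2 * Real.pi / (M i j : ℝ))) ht
    obtain ⟨k1, k2⟩ := S_zero_aux (M i j) h3 _ rfl
    rw [k1, k2] at this
    simpa [grefl] using this

theorem simple_inj (cs : CoxeterSystem M W) {i j : B} (h : cs.simple i = cs.simple j) : i = j := by
  by_contra hij
  have h' := congrArg (cs.lift ⟨grefl M, grefl_liftable M⟩) h
  rw [cs.lift_apply_simple, cs.lift_apply_simple] at h'
  have h2 := DFunLike.congr_fun h' (Finsupp.single i 1)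
  rw [grefl_apply, grefl_apply, gform_self] at h2
  have h3 := DFunLike.congr_fun h2 i
  simp [Ne.symm hij] at h3

/-! ### The inversion cocycle -/

theorem end_mul_apply {X : Type*} (f g : Function.End X) (x : X) : (f * g) x = f (g x) := rfl

theorem end_one_apply {X : Type*} (x : X) : (1 : Function.End X) x = x := rfl

open Classical in
/-- Action of a simple reflection on `W × ZMod 2`. -/
noncomputable def pf (cs : CoxeterSystem M W) (i : B) : Function.End (W × ZMod 2) :=
  fun x => (cs.simple i * x.1 * cs.simple i, x.2 + if x.1 = cs.simple i then 1 else 0)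

open Classical in
theorem pf_pow (cs : CoxeterSystem M W) (i j : B) (n : ℕ) (t : W) (e : ZMod 2) :
    ((pf cs i * pf cs j) ^ n) (t, e) =
      ((cs.simple i * cs.simple j) ^ n * t * ((cs.simple i * cs.simple j) ^ n)⁻¹,
        e + ∑ k ∈ Finset.range (2 * n),
          if t = cs.simple j * (cs.simple i * cs.simple j) ^ k then 1 else 0) := by
  induction n with
  | zero => simp [end_one_apply]
  | succ n ih =>
    have hc : ∀ n : ℕ, ((cs.simple i * cs.simple j) ^ n)⁻¹ * cs.simple j =
        cs.simple j * (cs.simple i * cs.simple j) ^ n := by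
      intro n
      induction n with
      | zero => simp
      | succ n ih =>
        rw [pow_succ', mul_inv_rev, mul_assoc, mul_inv_rev, mul_assoc, cs.inv_simple, cs.inv_simple]
        rw [← mul_assoc (cs.simple j) (cs.simple i), mul_assoc, ]
        rw [← mul_assoc, ← mul_assoc, ih]
        simp only [← pow_succ, ← pow_succ', mul_assoc]
    have h1 : ((cs.simple i * cs.simple j) ^ n * t * ((cs.simple i * cs.simple j) ^ n)⁻¹
        = cs.simple j) ↔ t = cs.simple j * (cs.simple i * cs.simple j) ^ (2 * n) := by
      rw [two_mul, pow_add, ← mul_assoc, ← hc n, mul_inv_eq_iff_eq_mul, mul_assoc,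
        eq_inv_mul_iff_mul_eq]
    have h2 : (cs.simple j * ((cs.simple i * cs.simple j) ^ n * t *
        ((cs.simple i * cs.simple j) ^ n)⁻¹) * cs.simple j
        = cs.simple i) ↔ t = cs.simple j * (cs.simple i * cs.simple j) ^ (2 * n + 1) := by
      have e : cs.simple j * (cs.simple i * cs.simple j) ^ (2 * n + 1) =
          ((cs.simple i * cs.simple j) ^ n)⁻¹ * (cs.simple j * cs.simple i * cs.simple j) *
            (cs.simple i * cs.simple j) ^ n := by
        rw [show 2 * n + 1 = n + (1 + n) by ring, pow_add, pow_add, ← mul_assoc, ← hc n]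
        simp only [mul_assoc, pow_one]
      rw [e]
      constructor
      · intro h
        have h' := congrArg (fun x => ((cs.simple i * cs.simple j) ^ n)⁻¹ *
          (cs.simple j * x * cs.simple j) * (cs.simple i * cs.simple j) ^ n) h
        simpa [mul_assoc] using h'
      · intro h
        rw [h]
        simp [mul_assoc]
    rw [pow_succ', end_mul_apply, ih]
    rw [end_mul_apply]
    rw [show 2 * (n + 1) = 2 * n + 1 + 1 by ring, Finset.sum_range_succ, Finset.sum_range_succ]
    simp only [pf, h1, h2]
    ext1
    · simp [pow_succ', mul_assoc]
    · simp [add_assoc]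

open Classical in
theorem pf_liftable (cs : CoxeterSystem M W) : M.IsLiftable (pf cs) := by
  intro i j
  funext x
  obtain ⟨t, e⟩ := x
  rw [pf_pow, two_mul, Finset.sum_range_add]
  have : ∀ k, (cs.simple i * cs.simple j) ^ (M i j + k) = (cs.simple i * cs.simple j) ^ k := by
    intro k
    rw [pow_add, cs.simple_mul_simple_pow, one_mul]
  simp only [this, cs.simple_mul_simple_pow]
  rw [CharTwo.add_self_eq_zero]
  simp [end_one_apply]

/-- The action of `W` on `W × ZMod 2`. -/
noncomputable def act (cs : CoxeterSystem M W) : W →* Function.End (W × ZMod 2) :=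
  cs.lift ⟨pf cs, pf_liftable cs⟩

/-- The inversion cocycle. -/
noncomputable def eta (cs : CoxeterSystem M W) (w t : W) : ZMod 2 := (act cs w (t, 0)).2

open Classical in
theorem act_word (cs : CoxeterSystem M W) (ω : List B) (t : W) (e : ZMod 2) :
    act cs (cs.wordProd ω) (t, e) =
      (cs.wordProd ω * t * (cs.wordProd ω)⁻¹, e + ((cs.rightInvSeq ω).count t : ZMod 2)) := by
  induction ω with
  | nil => simp [end_one_apply]
  | cons i ω ih =>
    rw [cs.wordProd_cons, map_mul, end_mul_apply, ih]
    rw [act, cs.lift_apply_simple, pf, CoxeterSystem.rightInvSeq, List.count_cons]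
    ext1
    · simp [mul_assoc]
    · have : (cs.wordProd ω * t * (cs.wordProd ω)⁻¹ = cs.simple i) ↔
          (cs.wordProd ω)⁻¹ * cs.simple i * cs.wordProd ω = t := by
        constructor
        · intro h; rw [← h]; group
        · intro h; rw [← h]; group
      simp only [this, beq_iff_eq]
      push_cast
      rw [add_assoc]

open Classical in
theorem eta_word (cs : CoxeterSystem M W) (ω : List B) (t : W) :
    eta cs (cs.wordProd ω) t = ((cs.rightInvSeq ω).count t : ZMod 2) := by
  rw [eta, act_word]; simp

theorem act_eq (cs : CoxeterSystem M W) (w t : W) (e : ZMod 2) :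
    act cs w (t, e) = (w * t * w⁻¹, e + eta cs w t) := by
  classical
  obtain ⟨ω, rfl⟩ := cs.wordProd_surjective w
  rw [eta_word, act_word]

theorem eta_mul (cs : CoxeterSystem M W) (w w' t : W) :
    eta cs (w * w') t = eta cs w' t + eta cs w (w' * t * w'⁻¹) := by
  rw [eta, map_mul, end_mul_apply, act_eq, act_eq]
  simp

theorem eta_one (cs : CoxeterSystem M W) (t : W) : eta cs 1 t = 0 := by
  simp [eta, end_one_apply]

theorem eta_simple (cs : CoxeterSystem M W) (i : B) : eta cs (cs.simple i) (cs.simple i) = 1 := by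
  classical
  have := eta_word cs [i] (cs.simple i)
  simpa using this

theorem eta_refl (cs : CoxeterSystem M W) (t : W) (ht : cs.IsReflection t) : eta cs t t = 1 := by
  obtain ⟨u, i, rfl⟩ := ht
  have h := eta_mul cs u u⁻¹ (u * cs.simple i * u⁻¹)
  rw [mul_inv_cancel, eta_one] at h
  rw [eta_mul, eta_mul]
  have e1 : u⁻¹ * (u * cs.simple i * u⁻¹) * u⁻¹⁻¹ = cs.simple i := by group
  rw [e1] at h ⊢
  rw [eta_simple]
  have e2 : cs.simple i * cs.simple i * (cs.simple i)⁻¹ = cs.simple i := by group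
  rw [e2]
  linear_combination -h

theorem lt_of_eta (cs : CoxeterSystem M W) (w t : W) (h : eta cs w t = 1) :
    cs.length (w * t) < cs.length w := by
  classical
  obtain ⟨ω, hω, rfl⟩ := cs.exists_isReduced w
  rw [eta_word] at h
  have : t ∈ cs.rightInvSeq ω := by
    by_contra hn
    rw [List.count_eq_zero_of_not_mem hn] at h
    simp at h
  exact (cs.isRightInversion_of_mem_rightInvSeq hω this).2

theorem eta_of_lt (cs : CoxeterSystem M W) (w t : W) (ht : cs.IsReflection t)
    (h : cs.length (w * t) < cs.length w) : eta cs w t = 1 := by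
  have h01 : ∀ a : ZMod 2, a = 0 ∨ a = 1 := by decide
  rcases h01 (eta cs w t) with h0 | h1
  · exfalso
    have : eta cs (w * t) t = 1 := by
      rw [eta_mul, eta_refl cs t ht]
      simp [h0]
    have := lt_of_eta cs _ _ this
    rw [mul_assoc, ht.mul_self, mul_one] at this
    omega
  · exact h1

theorem exchange (cs : CoxeterSystem M W) (ω : List B) (i : B)
    (h : cs.length (cs.wordProd ω * cs.simple i) < cs.length (cs.wordProd ω)) :
    ∃ k, k < ω.length ∧ cs.wordProd ω * cs.simple i = cs.wordProd (ω.eraseIdx k) := by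
  classical
  have h1 := eta_of_lt cs _ _ (cs.isReflection_simple i) h
  rw [eta_word] at h1
  have hmem : cs.simple i ∈ cs.rightInvSeq ω := by
    by_contra hn
    rw [List.count_eq_zero_of_not_mem hn] at h1
    simp at h1
  obtain ⟨k, hk, hk2⟩ := List.mem_iff_getElem.mp hmem
  refine ⟨k, by simpa using hk, ?_⟩
  rw [← cs.wordProd_mul_getD_rightInvSeq, List.getD_eq_getElem _ 1 hk, hk2]

/-! ### Parabolic subgroups -/

theorem simple_mem (cs : CoxeterSystem M W) {K : Set B} {i : B} (hi : i ∈ K) :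
    cs.simple i ∈ par cs K := Subgroup.subset_closure ⟨i, hi, rfl⟩

theorem word_mem (cs : CoxeterSystem M W) {K : Set B} (ω : List B) (h : ∀ i ∈ ω, i ∈ K) :
    cs.wordProd ω ∈ par cs K := by
  induction ω with
  | nil => simpa using one_mem _
  | cons i ω ih =>
    rw [cs.wordProd_cons]
    exact mul_mem (simple_mem cs (h i (by simp))) (ih fun j hj => h j (by simp [hj]))

theorem exists_word (cs : CoxeterSystem M W) {K : Set B} {w : W} (hw : w ∈ par cs K) :
    ∃ ω : List B, (∀ i ∈ ω, i ∈ K) ∧ w = cs.wordProd ω := by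
  induction hw using Subgroup.closure_induction with
  | mem x hx =>
    obtain ⟨i, hi, rfl⟩ := hx
    exact ⟨[i], by simpa using hi, by simp⟩
  | one => exact ⟨[], by simp, by simp⟩
  | mul x y _ _ hx hy =>
    obtain ⟨a, ha, rfl⟩ := hx
    obtain ⟨b, hb, rfl⟩ := hy
    refine ⟨a ++ b, ?_, by rw [cs.wordProd_append]⟩
    intro i hi
    rcases List.mem_append.mp hi with h | h
    · exact ha i h
    · exact hb i h
  | inv x _ hx =>
    obtain ⟨a, ha, rfl⟩ := hx
    exact ⟨a.reverse, by simpa using ha, by simp⟩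

theorem reduce_word (cs : CoxeterSystem M W) {K : Set B} (ω : List B) (h : ∀ i ∈ ω, i ∈ K) :
    ∃ ω' : List B, (∀ i ∈ ω', i ∈ K) ∧ cs.IsReduced ω' ∧ cs.wordProd ω = cs.wordProd ω' := by
  induction ω using List.reverseRecOn with
  | nil => exact ⟨[], by simp, by simp [CoxeterSystem.IsReduced], rfl⟩
  | append_singleton ω i ih =>
    obtain ⟨a, ha, hr, he⟩ := ih fun j hj => h j (by simp [hj])
    have hi : i ∈ K := h i (by simp)
    rw [cs.wordProd_append, cs.wordProd_singleton, he]
    rcases cs.length_mul_simple (cs.wordProd a) i with hl | hl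
    · refine ⟨a ++ [i], ?_, ?_, by rw [cs.wordProd_append, cs.wordProd_singleton]⟩
      · intro j hj
        rcases List.mem_append.mp hj with h | h
        · exact ha j h
        · rw [List.mem_singleton.mp h]; exact hi
      · rw [CoxeterSystem.IsReduced, cs.wordProd_append, cs.wordProd_singleton, hl, hr.eq]
        simp
    · obtain ⟨k, hk, hk2⟩ := exchange cs a i (by omega)
      refine ⟨a.eraseIdx k, fun j hj => ha j (List.mem_of_mem_eraseIdx hj), ?_, hk2⟩
      rw [CoxeterSystem.IsReduced, ← hk2]
      have := List.length_eraseIdx_add_one hk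
      have := hr.eq
      omega

theorem exists_reduced (cs : CoxeterSystem M W) {K : Set B} {w : W} (hw : w ∈ par cs K) :
    ∃ ω : List B, (∀ i ∈ ω, i ∈ K) ∧ cs.IsReduced ω ∧ w = cs.wordProd ω := by
  obtain ⟨ω, h, rfl⟩ := exists_word cs hw
  exact reduce_word cs ω h

theorem eq_simple_of_length_one (cs : CoxeterSystem M W) {K : Set B} {w : W}
    (hw : w ∈ par cs K) (h1 : cs.length w = 1) : ∃ i ∈ K, w = cs.simple i := by
  obtain ⟨ω, h, hr, rfl⟩ := exists_reduced cs hw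
  rw [hr.eq] at h1
  obtain ⟨i, rfl⟩ := List.length_eq_one_iff.mp h1
  exact ⟨i, h i (by simp), by simp⟩

theorem mem_of_simple_mem (cs : CoxeterSystem M W) {K : Set B} {i : B}
    (hi : cs.simple i ∈ par cs K) : i ∈ K := by
  obtain ⟨j, hj, h⟩ := eq_simple_of_length_one cs hi (cs.length_simple i)
  rw [simple_inj cs h]; exact hj

theorem longest_mul (cs : CoxeterSystem M W) {K : Set B} {y : W} (hy : IsLongest cs K y)
    (ω : List B) (h : ∀ i ∈ ω, i ∈ K) (hr : cs.IsReduced ω) :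
    cs.length (y * cs.wordProd ω) + ω.length = cs.length y := by
  induction ω using List.reverseRecOn with
  | nil => simp
  | append_singleton ω i ih =>
    have hω : ∀ j ∈ ω, j ∈ K := fun j hj => h j (by simp [hj])
    have hi : i ∈ K := h i (by simp)
    have hr' : cs.IsReduced ω := by
      have := hr.take ω.length
      simpa using this
    have ih := ih hω hr'
    set v := cs.wordProd ω with hv
    have hvm : v ∈ par cs K := word_mem cs ω hω
    have hvs : cs.length (v * cs.simple i) = cs.length v + 1 := by
      have e := hr.eq
      rw [cs.wordProd_append, cs.wordProd_singleton] at e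
      rw [e, hr'.eq]; simp
    have hrefl : cs.IsReflection (v * cs.simple i * v⁻¹) := ⟨v, i, rfl⟩
    have hlt : cs.length (y * (v * cs.simple i * v⁻¹)) < cs.length y := by
      apply lt_of_le_of_ne
      · exact hy.2 _ (mul_mem hy.1 (mul_mem (mul_mem hvm (simple_mem cs hi)) (inv_mem hvm)))
      · exact hrefl.length_mul_left_ne y
    have he1 := eta_of_lt cs y _ hrefl hlt
    have he0 : eta cs v (cs.simple i) = 0 := by
      have h01 : ∀ a : ZMod 2, a = 0 ∨ a = 1 := by decide
      rcases h01 (eta cs v (cs.simple i)) with h0 | h1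
      · exact h0
      · have := lt_of_eta cs _ _ h1
        omega
    have : eta cs (y * v) (cs.simple i) = 1 := by rw [eta_mul, he0, he1, zero_add]
    have hl := lt_of_eta cs _ _ this
    have := cs.length_mul_simple (y * v) i
    rw [cs.wordProd_append, cs.wordProd_singleton, ← mul_assoc, ← hv]
    simp only [List.length_append, List.length_singleton]
    omega

theorem longest_mul' (cs : CoxeterSystem M W) {K : Set B} {y : W} (hy : IsLongest cs K y)
    {w : W} (hw : w ∈ par cs K) :
    cs.length (y * w) + cs.length w = cs.length y := by
  obtain ⟨ω, h, hr, rfl⟩ := exists_reduced cs hw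
  rw [hr.eq]
  exact longest_mul cs hy ω h hr

theorem longest_sq_s2 (cs : CoxeterSystem M W) {K : Set B} {y : W} (hy : IsLongest cs K y) :
    y * y = 1 := by
  have := longest_mul' cs hy hy.1
  exact cs.length_eq_zero_iff.mp (by omega)

theorem longest_conj (cs : CoxeterSystem M W) {K : Set B} {y : W} (hy : IsLongest cs K y)
    {i : B} (hi : i ∈ K) : ∃ u ∈ K, y * cs.simple i * y = cs.simple u := by
  have hs := simple_mem cs hi
  apply eq_simple_of_length_one cs (mul_mem (mul_mem hy.1 hs) hy.1)
  have h1 := longest_mul' cs hy (mul_mem hs hy.1)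
  have h2 := longest_mul' cs hy hs
  have h3 : cs.length (cs.simple i * y) = cs.length (y * cs.simple i) := by
    have hinv : y⁻¹ = y := inv_eq_of_mul_eq_one_left (longest_sq_s2 cs hy)
    rw [← cs.length_inv (y * cs.simple i), mul_inv_rev, hinv, cs.inv_simple]
  rw [cs.length_simple] at h2
  rw [mul_assoc]
  omega

/-- Conjugation by the longest element. -/
theorem conj_mem (cs : CoxeterSystem M W) {K : Set B} {y : W} (hy : IsLongest cs K y)
    {s t : B} (h : cs.simple t = y * cs.simple s * y) {a : W} (ha : a ∈ par cs (K \ {s})) :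
    y * a * y ∈ par cs (K \ {t}) := by
  have hyy := longest_sq_s2 cs hy
  have hinv : y⁻¹ = y := inv_eq_of_mul_eq_one_left hyy
  induction ha using Subgroup.closure_induction with
  | mem x hx =>
    obtain ⟨i, ⟨hi, his⟩, rfl⟩ := hx
    obtain ⟨u, hu, hu2⟩ := longest_conj cs hy hi
    rw [hu2]
    apply simple_mem
    refine ⟨hu, ?_⟩
    rintro rfl
    apply his
    rw [← hu2] at h
    exact simple_inj cs (mul_left_cancel (mul_right_cancel h))
  | one => simp [hyy, one_mem]
  | mul x z _ _ hx hz =>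
    have := mul_mem hx hz
    have e : y * x * y * (y * z * y) = y * x * (y * y) * z * y := by group
    rw [e, hyy] at this
    simpa [mul_assoc] using this
  | inv x _ hx =>
    have := inv_mem hx
    simpa [mul_inv_rev, hinv, mul_assoc] using this

theorem statement_2 (cs : CoxeterSystem M W) (K : Set B) (hK : Finitary cs K)
    (s t : B) (hs : s ∈ K) (ht : t ∈ K) (wK : W) (hwK : IsLongest cs K wK) :
    IsCore cs (K \ {s}) wK (K \ {t}) ↔ cs.simple t = wK * cs.simple s * wK := by
  have hyy := longest_sq_s2 cs hwK
  constructor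
  · rintro ⟨h1, h2⟩
    have h := h1.trans h2
    obtain ⟨u, hu, hu2⟩ := longest_conj cs hwK hs
    by_cases hut : u = t
    · rw [hu2, hut]
    · exfalso
      have hm : cs.simple u ∈ par cs (K \ {t}) := simple_mem cs ⟨hu, hut⟩
      have : wK * cs.simple u ∈ rcos cs wK (K \ {t}) := ⟨_, hm, rfl⟩
      rw [← h] at this
      obtain ⟨a, ha, hae⟩ := this
      have e : wK * cs.simple u = cs.simple s * wK := by
        rw [← hu2, mul_assoc, ← mul_assoc wK, hyy, one_mul]
      rw [e] at hae
      rw [← mul_right_cancel hae] at ha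
      exact (mem_of_simple_mem cs ha).2 rfl
  · intro h
    have h' : cs.simple s = wK * cs.simple t * wK := by
      rw [h]
      have e : wK * (wK * cs.simple s * wK) * wK = (wK * wK) * cs.simple s * (wK * wK) := by group
      rw [e, hyy]; simp
    have key : ∀ x : W, wK * (wK * x) = x := fun x => by rw [← mul_assoc, hyy, one_mul]
    constructor
    · ext w
      constructor
      · rintro ⟨a, ha, rfl⟩
        exact ⟨a, ha, 1, one_mem _, by simp⟩
      · rintro ⟨a, ha, b, hb, rfl⟩
        refine ⟨a * (wK * b * wK), mul_mem ha (conj_mem cs hwK h' hb), ?_⟩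
        simp [mul_assoc, hyy]
    · ext w
      constructor
      · rintro ⟨a, ha, b, hb, rfl⟩
        refine ⟨(wK * a * wK) * b, mul_mem (conj_mem cs hwK h ha) hb, ?_⟩
        simp [mul_assoc, key]
      · rintro ⟨b, hb, rfl⟩
        exact ⟨1, one_mem _, b, hb, by simp⟩

end CoxeterAtoms
end
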